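/- Let η : ℝ² → ℝ, let ρ₀ ∈ (0,2) and θ₀ ∈ ℝ, and set z₁ := ρ₀·exp(iθ₀). For k ∈ ℤ set r_k⁻ := exp(θ₀/2 − (arccos(ρ₀/2))/2 + πk) and r_k⁺ := exp(θ₀/2 + (arccos(ρ₀/2))/2 + πk). Then for every z₂, z₃ ∈ ℂ∖{0} with η(log|z₂|², log|z₃|²) = 0, the point (z₁,z₂,z₃) belongs to W_η if and only if there exists k ∈ ℤ with r_k⁻ < |z₂z₃| < r_k⁺. -/

import Mathlib

open Complex

/-- The worm-type set `W_η ⊆ ℂ³`. -/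
noncomputable def wormSet (η : ℝ × ℝ → ℝ) : Set (ℂ × ℂ × ℂ) :=
  {z | z.2.1 ≠ 0 ∧ z.2.2 ≠ 0 ∧
    ‖z.1 - Complex.exp (Complex.I *
        ((Real.log (‖z.2.1 * z.2.2‖ ^ 2) : ℝ) : ℂ))‖ ^ 2 <
      1 - η (Real.log (‖z.2.1‖ ^ 2), Real.log (‖z.2.2‖ ^ 2))}

lemma cos_gt_iff_aux (c x : ℝ) (h0 : 0 < c) (h1 : c < 1) :
    c < Real.cos x ↔ ∃ k : ℤ, |x - 2 * Real.pi * k| < Real.arccos c := by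
  have hpi := Real.pi_pos
  have hcos : Real.cos (Real.arccos c) = c := Real.cos_arccos (by linarith) h1.le
  have hper : ∀ k : ℤ, Real.cos |x - 2 * Real.pi * k| = Real.cos x := by
    intro k
    rw [Real.cos_abs, show x - 2 * Real.pi * k = x - k * (2 * Real.pi) by ring,
      Real.cos_sub_int_mul_two_pi]
  have hmem : Real.arccos c ∈ Set.Icc 0 Real.pi :=
    ⟨Real.arccos_nonneg c, Real.arccos_le_pi c⟩
  constructor
  · intro h
    refine ⟨round (x / (2 * Real.pi)), ?_⟩
    have hr := abs_sub_round (x / (2 * Real.pi))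
    set k := round (x / (2 * Real.pi))
    have hle : |x - 2 * Real.pi * k| ≤ Real.pi := by
      have : x - 2 * Real.pi * k = (2 * Real.pi) * (x / (2 * Real.pi) - k) := by
        field_simp
      rw [this, abs_mul, abs_of_pos (by positivity : (0 : ℝ) < 2 * Real.pi)]
      nlinarith
    rw [← Real.strictAntiOn_cos.lt_iff_gt hmem ⟨abs_nonneg _, hle⟩, hper, hcos]
    exact h
  · rintro ⟨k, hk⟩
    have := Real.strictAntiOn_cos ⟨abs_nonneg _, hk.le.trans hmem.2⟩ hmem hk
    rwa [hper, hcos] at this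

lemma norm_sq_aux (ρ θ L : ℝ) :
    ‖(ρ : ℂ) * Complex.exp (Complex.I * (θ : ℂ)) - Complex.exp (Complex.I * (L : ℂ))‖ ^ 2
      = ρ ^ 2 + 1 - 2 * ρ * Real.cos (L - θ) := by
  rw [Complex.sq_norm, Complex.normSq_apply, mul_comm Complex.I, mul_comm Complex.I, Real.cos_sub]
  simp only [Complex.sub_re, Complex.sub_im, Complex.re_ofReal_mul, Complex.im_ofReal_mul,
    Complex.exp_ofReal_mul_I_re, Complex.exp_ofReal_mul_I_im]
  have h1 := Real.sin_sq_add_cos_sq θ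
  have h2 := Real.sin_sq_add_cos_sq L
  linear_combination ρ ^ 2 * h1 + h2

/-- Description of the fiber of `W_η` over a point `z₁ = ρ₀ e^{iθ₀}` of the first
coordinate, restricted to `(z₂,z₃)` with `η(log|z₂|², log|z₃|²) = 0`:
the point belongs to `W_η` iff `r_k⁻ < |z₂z₃| < r_k⁺` for some `k ∈ ℤ`. -/
theorem wormSet_fiber (η : ℝ × ℝ → ℝ) (ρ₀ θ₀ : ℝ) (hρ₀ : 0 < ρ₀) (hρ₀' : ρ₀ < 2)
    (z₂ z₃ : ℂ) (h2 : z₂ ≠ 0) (h3 : z₃ ≠ 0)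
    (hη : η (Real.log (‖z₂‖ ^ 2), Real.log (‖z₃‖ ^ 2)) = 0) :
    ((ρ₀ : ℂ) * Complex.exp (Complex.I * (θ₀ : ℂ)), z₂, z₃) ∈ wormSet η ↔
      ∃ k : ℤ,
        Real.exp (θ₀ / 2 - Real.arccos (ρ₀ / 2) / 2 + Real.pi * k) < ‖z₂ * z₃‖ ∧
        ‖z₂ * z₃‖ < Real.exp (θ₀ / 2 + Real.arccos (ρ₀ / 2) / 2 + Real.pi * k) := by
  have hr : 0 < ‖z₂ * z₃‖ := norm_pos_iff.mpr (mul_ne_zero h2 h3)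
  simp only [wormSet, Set.mem_setOf_eq, hη, sub_zero, norm_sq_aux]
  have hkey := cos_gt_iff_aux (ρ₀ / 2) (Real.log (‖z₂ * z₃‖ ^ 2) - θ₀) (by linarith) (by linarith)
  have hfirst : (ρ₀ ^ 2 + 1 - 2 * ρ₀ * Real.cos (Real.log (‖z₂ * z₃‖ ^ 2) - θ₀) < 1) ↔
      ρ₀ / 2 < Real.cos (Real.log (‖z₂ * z₃‖ ^ 2) - θ₀) := by
    constructor
    · intro h
      by_contra! hc
      nlinarith
    · intro h
      nlinarith
  rw [hfirst, hkey]
  simp only [ne_eq, h2, h3, not_false_eq_true, true_and]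
  refine exists_congr fun k => ?_
  rw [← Real.lt_log_iff_exp_lt hr, ← Real.log_lt_iff_lt_exp hr, Real.log_pow, abs_lt]
  push_cast
  constructor
  · rintro ⟨ha, hb⟩
    constructor <;> linarith
  · rintro ⟨ha, hb⟩
    constructor <;> linarith
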